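/- arXiv:1809.08124 — 2 statements merged into one kernel-verified Lean document; each statement's English description precedes it below -/
import Mathlib

section
/- For every real t > 0 and every natural number m, (∂²J_ν(t)/∂ν²)|_{ν=m} + (−1)^{m+1}·(∂²J_ν(t)/∂ν²)|_{ν=−m} = 2π·(∂Y_ν(t)/∂ν)|_{ν=m} + π²·J_m(t). -/
open Real MeasureTheory

/-- Bessel function of the first kind via Schläfli's integral representation. -/
noncomputable def besselJ (ν t : ℝ) : ℝ :=
  (1 / π) * ∫ x in (0:ℝ)..π, Real.cos (t * Real.sin x - ν * x)
    - (Real.sin (ν * π) / π) * ∫ x in Set.Ioi (0:ℝ), Real.exp (-(t * Real.sinh x) - ν * x)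

/-- Bessel function of the second kind via its integral representation. -/
noncomputable def besselY (ν t : ℝ) : ℝ :=
  (1 / π) * ∫ x in (0:ℝ)..π, Real.sin (t * Real.sin x - ν * x)
    - (1 / π) * ∫ x in Set.Ioi (0:ℝ),
        Real.exp (-(t * Real.sinh x)) *
          (Real.exp (ν * x) + Real.exp (-(ν * x)) * Real.cos (ν * π))

/-- The exponential integral `∫₀^∞ exp (-t sinh x - ν x) dx` in Schläfli's representation. -/
noncomputable def schlafliTail (t ν : ℝ) : ℝ :=
  ∫ x in Set.Ioi (0:ℝ), Real.exp (-(t * Real.sinh x) - ν * x)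

lemma sq_div_four_le_sinh {x : ℝ} (hx : 0 ≤ x) : x ^ 2 / 4 ≤ Real.sinh x := by
  have h1 := Real.quadratic_le_exp_of_nonneg hx
  have h2 : Real.exp (-x) ≤ 1 := Real.exp_le_one_iff.mpr (by linarith)
  rw [Real.sinh_eq]
  linarith

lemma integrableOn_exp_neg_sinh_sub {t : ℝ} (ht : 0 < t) (ν : ℝ) :
    IntegrableOn (fun x => Real.exp (-(t * Real.sinh x) - ν * x)) (Set.Ioi 0) := by
  refine integrable_of_isBigO_exp_neg one_pos (by fun_prop) (Asymptotics.IsBigO.of_bound 1 ?_)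
  filter_upwards [Filter.eventually_ge_atTop 0,
    Filter.eventually_ge_atTop (4 * (1 - ν) / t)] with x hx0 hx
  rw [Real.norm_of_nonneg (Real.exp_nonneg _), Real.norm_of_nonneg (Real.exp_nonneg _), one_mul,
    Real.exp_le_exp]
  have h1 := mul_le_mul_of_nonneg_left (sq_div_four_le_sinh hx0) ht.le
  rw [div_le_iff₀ ht] at hx
  have h2 := mul_le_mul_of_nonneg_right hx hx0
  linarith

lemma analyticAt_schlafliTail {t : ℝ} (ht : 0 < t) (ν : ℝ) :
    AnalyticAt ℝ (schlafliTail t) ν := by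
  set d : ℝ → NNReal := fun x => (Real.exp (-(t * Real.sinh x))).toNNReal with hd
  have hdm : Measurable d := by fun_prop
  set μ : Measure ℝ := (volume.restrict (Set.Ioi 0)).withDensity fun x => (d x : ENNReal) with hμ
  have hd_smul (ν x : ℝ) :
      d x • Real.exp (-ν * x) = Real.exp (-(t * Real.sinh x) - ν * x) := by
    rw [NNReal.smul_def, hd, Real.coe_toNNReal _ (Real.exp_nonneg _), smul_eq_mul, ← Real.exp_add]
    ring_nf
  have hset : ProbabilityTheory.integrableExpSet id μ = Set.univ := by
    refine Set.eq_univ_of_forall fun s => ?_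
    have h := integrableOn_exp_neg_sinh_sub ht (-s)
    simp_rw [IntegrableOn, ← hd_smul, neg_neg] at h
    exact (integrable_withDensity_iff_integrable_smul hdm).mpr h
  have htail : schlafliTail t = fun ν => ProbabilityTheory.mgf id μ (-ν) := by
    funext ν
    simp only [schlafliTail, ProbabilityTheory.mgf, id, hμ]
    rw [integral_withDensity_eq_integral_smul hdm]
    simp_rw [hd_smul]
  rw [htail]
  exact (ProbabilityTheory.analyticAt_mgf (by simp [hset])).fun_comp analyticAt_id.neg

lemma hasDerivAt_integral_mul_cos_sub {g h : ℝ → ℝ} (hg : Continuous g) (hh : Continuous h)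
    (a b ν : ℝ) :
    HasDerivAt (fun ν => ∫ x in a..b, g x * Real.cos (h x - ν * x))
      (∫ x in a..b, g x * x * Real.sin (h x - ν * x)) ν := by
  refine (intervalIntegral.hasDerivAt_integral_of_dominated_loc_of_deriv_le
    (F := fun ν x => g x * Real.cos (h x - ν * x))
    (F' := fun ν x => g x * x * Real.sin (h x - ν * x))
    (bound := fun x => |g x * x|) Filter.univ_mem
    (Filter.Eventually.of_forall fun ν => ?_) ?_ ?_ ?_ ?_ ?_).2
  · exact Continuous.aestronglyMeasurable (by fun_prop)
  · exact Continuous.intervalIntegrable (by fun_prop) _ _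
  · exact Continuous.aestronglyMeasurable (by fun_prop)
  · refine Filter.Eventually.of_forall fun x _ ν _ => ?_
    rw [norm_mul]
    exact mul_le_of_le_one_right (norm_nonneg _) (Real.abs_sin_le_one _)
  · exact Continuous.intervalIntegrable (by fun_prop) _ _
  · refine Filter.Eventually.of_forall fun x _ ν _ => ?_
    have hlin : HasDerivAt (fun ν => h x - ν * x) (-x) ν := by
      simpa using ((hasDerivAt_id ν).mul_const x).const_sub (h x)
    refine (hlin.cos.const_mul (g x)).congr_deriv ?_
    ring

lemma hasDerivAt_integral_mul_sin_sub {g h : ℝ → ℝ} (hg : Continuous g) (hh : Continuous h)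
    (a b ν : ℝ) :
    HasDerivAt (fun ν => ∫ x in a..b, g x * Real.sin (h x - ν * x))
      (-∫ x in a..b, g x * x * Real.cos (h x - ν * x)) ν := by
  have key := hasDerivAt_integral_mul_cos_sub hg (h := fun x => h x - π / 2) (by fun_prop) a b ν
  simp_rw [sub_right_comm _ (π / 2), Real.cos_sub_pi_div_two, Real.sin_sub_pi_div_two, mul_neg,
    intervalIntegral.integral_neg] at key
  exact key

lemma besselJ_eq (ν t : ℝ) :
    besselJ ν t = 1 / π * (∫ x in (0:ℝ)..π, Real.cos (t * Real.sin x - ν * x))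
      - Real.sin (ν * π) / π * schlafliTail t ν := by
  rw [besselJ, intervalIntegral.integral_sub (Continuous.intervalIntegrable (by fun_prop) _ _)
    intervalIntegrable_const, intervalIntegral.integral_const, schlafliTail, smul_eq_mul]
  field_simp
  ring

lemma besselY_eq {t : ℝ} (ht : 0 < t) (ν : ℝ) :
    besselY ν t = 1 / π * (∫ x in (0:ℝ)..π, Real.sin (t * Real.sin x - ν * x))
      - 1 / π * (schlafliTail t (-ν) + Real.cos (ν * π) * schlafliTail t ν) := by
  have htail : ∫ x in Set.Ioi (0:ℝ), Real.exp (-(t * Real.sinh x)) *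
      (Real.exp (ν * x) + Real.exp (-(ν * x)) * Real.cos (ν * π)) =
      schlafliTail t (-ν) + Real.cos (ν * π) * schlafliTail t ν := by
    rw [schlafliTail, schlafliTail, ← integral_const_mul,
      ← integral_add (integrableOn_exp_neg_sinh_sub ht _)
        ((integrableOn_exp_neg_sinh_sub ht _).const_mul _)]
    congr 1 with x
    rw [sub_eq_add_neg, sub_eq_add_neg, Real.exp_add, Real.exp_add, neg_mul, neg_neg]
    ring
  rw [besselY, htail, intervalIntegral.integral_sub
    (Continuous.intervalIntegrable (by fun_prop) _ _) intervalIntegrable_const,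
    intervalIntegral.integral_const, smul_eq_mul]
  field_simp
  ring

lemma iteratedDeriv_two_besselJ {t : ℝ} (ht : 0 < t) {ν : ℝ} (hν : Real.sin (ν * π) = 0) :
    iteratedDeriv 2 (fun ν : ℝ => besselJ ν t) ν =
      -(1 / π * ∫ x in (0:ℝ)..π, x ^ 2 * Real.cos (t * Real.sin x - ν * x))
        - 2 * Real.cos (ν * π) * deriv (schlafliTail t) ν := by
  have hlin (ν : ℝ) : HasDerivAt (fun ν : ℝ => ν * π) π ν := by
    simpa using (hasDerivAt_id ν).mul_const π
  have hT (ν : ℝ) := (analyticAt_schlafliTail ht ν).differentiableAt.hasDerivAt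
  have hT' := (analyticAt_schlafliTail ht ν).deriv.differentiableAt.hasDerivAt
  have hderiv : deriv (fun ν : ℝ => besselJ ν t) = fun ν =>
      1 / π * (∫ x in (0:ℝ)..π, x * Real.sin (t * Real.sin x - ν * x))
        - (Real.cos (ν * π) * schlafliTail t ν
          + Real.sin (ν * π) / π * deriv (schlafliTail t) ν) := by
    funext ν
    have hcos := hasDerivAt_integral_mul_cos_sub (g := fun _ => 1)
      (h := fun x => t * Real.sin x) (by fun_prop) (by fun_prop) 0 π ν
    simp only [one_mul] at hcos
    simp_rw [besselJ_eq]
    refine ((hcos.const_mul (1 / π)).sub (((hlin ν).sin.div_const π).mul (hT ν))).deriv.trans ?_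
    rw [mul_div_cancel_right₀ _ Real.pi_ne_zero]
  have hsin := hasDerivAt_integral_mul_sin_sub (g := fun x => x)
    (h := fun x => t * Real.sin x) (by fun_prop) (by fun_prop) 0 π ν
  rw [iteratedDeriv_succ, iteratedDeriv_one, hderiv]
  refine ((hsin.const_mul (1 / π)).sub (((hlin ν).cos.mul (hT ν)).add
    (((hlin ν).sin.div_const π).mul hT'))).deriv.trans ?_
  simp_rw [hν, mul_div_cancel_right₀ _ Real.pi_ne_zero, ← pow_two]
  ring

lemma deriv_besselY {t : ℝ} (ht : 0 < t) {ν : ℝ} (hν : Real.sin (ν * π) = 0) :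
    deriv (fun ν : ℝ => besselY ν t) ν =
      -(1 / π * ∫ x in (0:ℝ)..π, x * Real.cos (t * Real.sin x - ν * x))
        - 1 / π * (-deriv (schlafliTail t) (-ν)
          + Real.cos (ν * π) * deriv (schlafliTail t) ν) := by
  have hlin : HasDerivAt (fun ν : ℝ => ν * π) π ν := by
    simpa using (hasDerivAt_id ν).mul_const π
  have hT (ν : ℝ) := (analyticAt_schlafliTail ht ν).differentiableAt.hasDerivAt
  have hTneg : HasDerivAt (fun ν => schlafliTail t (-ν)) (-deriv (schlafliTail t) (-ν)) ν := by
    simpa [Function.comp_def] using (hT (-ν)).comp ν (hasDerivAt_neg ν)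
  have hsin := hasDerivAt_integral_mul_sin_sub (g := fun _ => 1)
    (h := fun x => t * Real.sin x) (by fun_prop) (by fun_prop) 0 π ν
  simp only [one_mul] at hsin
  simp_rw [besselY_eq ht]
  refine ((hsin.const_mul (1 / π)).sub
    ((hTneg.add (hlin.cos.mul (hT ν))).const_mul (1 / π))).deriv.trans ?_
  rw [hν]
  ring

lemma integral_sq_mul_cos_add_nat_mul (t : ℝ) (m : ℕ) :
    ∫ x in (0:ℝ)..π, x ^ 2 * Real.cos (t * Real.sin x + m * x) =
      (-1) ^ m * ∫ x in (0:ℝ)..π, (π - x) ^ 2 * Real.cos (t * Real.sin x - m * x) := by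
  have h := intervalIntegral.integral_comp_sub_left
    (fun x => x ^ 2 * Real.cos (t * Real.sin x + m * x)) π (a := 0) (b := π)
  rw [sub_self, sub_zero] at h
  rw [← h, ← intervalIntegral.integral_const_mul]
  congr 1 with x
  rw [Real.sin_pi_sub, show t * Real.sin x + m * (π - x) = t * Real.sin x - m * x + m * π by ring,
    Real.cos_add_nat_mul_pi]
  ring

theorem reflection_second_deriv_besselJ (t : ℝ) (ht : 0 < t) (m : ℕ) :
    iteratedDeriv 2 (fun ν : ℝ => besselJ ν t) m
      + (-1 : ℝ) ^ (m + 1) * iteratedDeriv 2 (fun ν : ℝ => besselJ ν t) (-(m : ℝ))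
      = 2 * π * deriv (fun ν : ℝ => besselY ν t) m + π ^ 2 * besselJ m t := by
  have hs : Real.sin (m * π) = 0 := Real.sin_nat_mul_pi m
  have hs' : Real.sin (-(m : ℝ) * π) = 0 := by rw [neg_mul, Real.sin_neg, hs, neg_zero]
  have hexpand : ∫ x in (0:ℝ)..π, (π - x) ^ 2 * Real.cos (t * Real.sin x - m * x) =
      π ^ 2 * (∫ x in (0:ℝ)..π, Real.cos (t * Real.sin x - m * x))
        - 2 * π * (∫ x in (0:ℝ)..π, x * Real.cos (t * Real.sin x - m * x))
        + ∫ x in (0:ℝ)..π, x ^ 2 * Real.cos (t * Real.sin x - m * x) := by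
    rw [← intervalIntegral.integral_const_mul, ← intervalIntegral.integral_const_mul,
      ← intervalIntegral.integral_sub, ← intervalIntegral.integral_add]
    · congr 1 with x
      ring
    all_goals exact Continuous.intervalIntegrable (by fun_prop) _ _
  have hsq : ((-1 : ℝ) ^ m) * (-1) ^ m = 1 := by rw [← mul_pow]; norm_num
  rw [iteratedDeriv_two_besselJ ht hs, iteratedDeriv_two_besselJ ht hs', deriv_besselY ht hs,
    besselJ_eq, hs, neg_mul, Real.cos_neg, Real.cos_nat_mul_pi]
  simp_rw [neg_mul, sub_neg_eq_add]
  rw [integral_sq_mul_cos_add_nat_mul, pow_succ]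
  linear_combination
    (1 / π * (∫ x in (0:ℝ)..π, (π - x) ^ 2 * Real.cos (t * Real.sin x - m * x))
      + 2 * deriv (schlafliTail t) (-(m : ℝ))) * hsq + 1 / π * hexpand
    + 2 * (-deriv (schlafliTail t) (-(m : ℝ)) + (-1) ^ m * deriv (schlafliTail t) m)
      * mul_inv_cancel₀ Real.pi_ne_zero
end

section
/- For every real t > 0, every real μ, and every natural number n, (∂ⁿI_ν(t)/∂νⁿ)|_{ν=μ} + (−1)^{n+1}·(∂ⁿI_ν(t)/∂νⁿ)|_{ν=−μ} = −(2/π)·sin(πμ)·Σ_{k=0}^{⌊n/2⌋} C(n,2k)·(−π²)^k·(∂^{n−2k}K_ν(t)/∂ν^{n−2k})|_{ν=μ} − 2·cos(πμ)·Σ_{k=0}^{⌊(n−1)/2⌋} C(n,2k+1)·(−π²)^k·(∂^{n−2k−1}K_ν(t)/∂ν^{n−2k−1})|_{ν=μ}. -/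
open Real MeasureTheory

/-- Modified Bessel function of the first kind via its integral representation. -/
noncomputable def besselI (ν t : ℝ) : ℝ :=
  (1 / π) * ∫ x in (0:ℝ)..π, Real.exp (t * Real.cos x) * Real.cos (ν * x)
    - (Real.sin (ν * π) / π) * ∫ x in Set.Ioi (0:ℝ), Real.exp (-(t * Real.cosh x) - ν * x)

/-- Modified Bessel function of the second kind (Macdonald function). -/
noncomputable def besselK (ν t : ℝ) : ℝ :=
  (1 / 2) * ∫ x : ℝ, Real.exp (ν * x - t * Real.cosh x)

open ProbabilityTheory in
/-- The two-sided Laplace transform of a nonnegative density with all exponential moments is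
entire. -/
lemma differentiable_integral_cexp_mul {m : Measure ℝ} {ρ : ℝ → ℝ} (hρ : Measurable ρ)
    (hρ0 : ∀ x, 0 ≤ ρ x) (hint : ∀ ν : ℝ, Integrable (fun x => ρ x * Real.exp (ν * x)) m) :
    Differentiable ℂ (fun z : ℂ => ∫ x, (ρ x : ℂ) * Complex.exp (z * x) ∂m) := by
  have hd : Measurable fun x => (ρ x).toNNReal := hρ.real_toNNReal
  let P : Measure ℝ := m.withDensity fun x => ((ρ x).toNNReal : ENNReal)
  have huniv : integrableExpSet (fun x : ℝ => x) P = Set.univ := by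
    refine Set.eq_univ_of_forall fun ν => ?_
    change Integrable _ _
    rw [integrable_withDensity_iff_integrable_smul hd]
    simpa [NNReal.smul_def, hρ0] using hint ν
  have hz : ∀ z, complexMGF (fun x : ℝ => x) P z = ∫ x, (ρ x : ℂ) * Complex.exp (z * x) ∂m := by
    intro z
    rw [complexMGF, integral_withDensity_eq_integral_smul hd]
    simp [NNReal.smul_def, hρ0]
  intro z
  simp_rw [← hz]
  exact (analyticAt_complexMGF (by simp [huniv])).differentiableAt

lemma contDiff_integral_exp_mul {m : Measure ℝ} {ρ : ℝ → ℝ} (hρ : Measurable ρ)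
    (hρ0 : ∀ x, 0 ≤ ρ x) (hint : ∀ ν : ℝ, Integrable (fun x => ρ x * Real.exp (ν * x)) m)
    (n : WithTop ℕ∞) :
    ContDiff ℝ n (fun ν : ℝ => ∫ x, ρ x * Real.exp (ν * x) ∂m) := by
  have h := (differentiable_integral_cexp_mul hρ hρ0 hint).contDiff (n := n)
  have hre : (fun ν : ℝ => ∫ x, ρ x * Real.exp (ν * x) ∂m)
      = fun ν : ℝ => (∫ x, (ρ x : ℂ) * Complex.exp (ν * x) ∂m).re := by
    funext ν
    rw [← Complex.ofReal_re (∫ x, ρ x * Real.exp (ν * x) ∂m), ← integral_complex_ofReal]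
    simp
  rw [hre]
  exact h.real_of_complex

lemma contDiff_integral_cos_mul {m : Measure ℝ} {ρ : ℝ → ℝ} (hρ : Measurable ρ)
    (hρ0 : ∀ x, 0 ≤ ρ x) (hint : ∀ ν : ℝ, Integrable (fun x => ρ x * Real.exp (ν * x)) m)
    (n : WithTop ℕ∞) :
    ContDiff ℝ n (fun ν : ℝ => ∫ x, ρ x * Real.cos (ν * x) ∂m) := by
  have h := (differentiable_integral_cexp_mul hρ hρ0 hint).comp
    (differentiable_id.mul_const Complex.I)
  have hre : (fun ν : ℝ => ∫ x, ρ x * Real.cos (ν * x) ∂m)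
      = fun ν : ℝ => (∫ x, (ρ x : ℂ) * Complex.exp (ν * Complex.I * x) ∂m).re := by
    funext ν
    have hi : Integrable (fun x : ℝ => (ρ x : ℂ) * Complex.exp (ν * Complex.I * x)) m := by
      refine (hint 0).mono' (by fun_prop) (Filter.Eventually.of_forall fun x => ?_)
      rw [norm_mul, mul_right_comm, ← Complex.ofReal_mul, Complex.norm_exp_ofReal_mul_I]
      simp [abs_of_nonneg (hρ0 x)]
    refine Eq.trans ?_ (integral_re hi)
    refine integral_congr_ae (Filter.Eventually.of_forall fun x => ?_)
    simp only [RCLike.re_to_complex, Complex.re_ofReal_mul]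
    rw [mul_right_comm, ← Complex.ofReal_mul, Complex.exp_ofReal_mul_I_re]
  rw [hre]
  exact (h.contDiff (n := n)).real_of_complex

lemma sq_div_four_le_cosh (x : ℝ) : x ^ 2 / 4 ≤ Real.cosh x := by
  have h := Real.quadratic_le_exp_of_nonneg (abs_nonneg x)
  rw [← Real.cosh_abs, Real.cosh_eq]
  have := Real.exp_pos (-|x|)
  have := abs_nonneg x
  rw [sq_abs] at h
  linarith

lemma integrable_exp_neg_mul_cosh_mul_exp {t : ℝ} (ht : 0 < t) (ν : ℝ) :
    Integrable fun x : ℝ => Real.exp (-(t * Real.cosh x)) * Real.exp (ν * x) := by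
  refine ((integrable_exp_neg_mul_sq (b := t / 8) (by positivity)).const_mul
    (Real.exp (2 * ν ^ 2 / t))).mono' (by fun_prop) (Filter.Eventually.of_forall fun x => ?_)
  rw [Real.norm_of_nonneg (by positivity), ← Real.exp_add, ← Real.exp_add, Real.exp_le_exp]
  have h₁ := mul_le_mul_of_nonneg_left (sq_div_four_le_cosh x) ht.le
  have h₂ : 0 ≤ t / 8 * (x - 4 * ν / t) ^ 2 := by positivity
  have h₃ : t / 8 * (x - 4 * ν / t) ^ 2 = t / 8 * x ^ 2 - ν * x + 2 * ν ^ 2 / t := by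
    field_simp
    ring
  linarith

lemma besselK_eq (ν t : ℝ) :
    besselK ν t = 1 / 2 * ∫ x : ℝ, Real.exp (-(t * Real.cosh x)) * Real.exp (ν * x) := by
  simp only [besselK, ← Real.exp_add, sub_eq_neg_add]

lemma besselI_eq (ν t : ℝ) :
    besselI ν t = 1 / π * (∫ x in Set.Ioc 0 π, Real.exp (t * Real.cos x) * Real.cos (ν * x))
      - Real.sin (π * ν) / π *
        ∫ x in Set.Ioi (0 : ℝ), Real.exp (-(t * Real.cosh x)) * Real.exp (-ν * x) := by
  rw [besselI, intervalIntegral.integral_sub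
    (Continuous.intervalIntegrable (by fun_prop) _ _) intervalIntegrable_const,
    intervalIntegral.integral_const, intervalIntegral.integral_of_le Real.pi_pos.le]
  simp only [← Real.exp_add, neg_mul, ← sub_eq_add_neg, smul_eq_mul, sub_zero, mul_comm ν π]
  field_simp

lemma contDiff_besselK {t : ℝ} (ht : 0 < t) (n : WithTop ℕ∞) :
    ContDiff ℝ n fun ν => besselK ν t := by
  simp only [besselK_eq]
  exact contDiff_const.mul (contDiff_integral_exp_mul (by fun_prop) (fun _ => by positivity)
    (integrable_exp_neg_mul_cosh_mul_exp ht) n)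

lemma contDiff_besselI {t : ℝ} (ht : 0 < t) (n : WithTop ℕ∞) :
    ContDiff ℝ n fun ν => besselI ν t := by
  simp only [besselI_eq]
  have hcos := contDiff_integral_cos_mul (m := volume.restrict (Set.Ioc 0 π))
    (ρ := fun x => Real.exp (t * Real.cos x)) (by fun_prop) (fun _ => by positivity)
    (fun ν => (Continuous.integrableOn_Icc (by fun_prop)).mono_set Set.Ioc_subset_Icc_self) n
  have hexp := contDiff_integral_exp_mul (m := volume.restrict (Set.Ioi 0))
    (ρ := fun x => Real.exp (-(t * Real.cosh x))) (by fun_prop) (fun _ => by positivity)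
    (fun ν => (integrable_exp_neg_mul_cosh_mul_exp ht ν).integrableOn) n
  have hneg := hexp.comp contDiff_neg
  have hsin : ContDiff ℝ n fun ν : ℝ => Real.sin (π * ν) / π := by fun_prop
  exact (contDiff_const.mul hcos).sub (hsin.mul hneg)

/-- The reflection formula `I_ν - I_{-ν} = -(2/π) sin(πν) K_ν`. -/
lemma besselI_sub_besselI_neg {t : ℝ} (ht : 0 < t) (ν : ℝ) :
    besselI ν t - besselI (-ν) t = -(2 / π) * (Real.sin (π * ν) * besselK ν t) := by
  have hi := integrable_exp_neg_mul_cosh_mul_exp ht ν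
  have hsplit := intervalIntegral.integral_Iic_add_Ioi (b := (0 : ℝ)) hi.integrableOn hi.integrableOn
  have hrefl := integral_comp_neg_Ioi (0 : ℝ)
    fun x => Real.exp (-(t * Real.cosh x)) * Real.exp (ν * x)
  simp only [Real.cosh_neg, mul_neg, neg_zero] at hrefl
  rw [besselI_eq, besselI_eq, besselK_eq, ← hsplit, ← hrefl]
  simp only [neg_mul, mul_neg, Real.cos_neg, Real.sin_neg, neg_neg]
  ring

lemma sum_range_succ_eq_even_add_odd {M : Type*} [AddCommMonoid M] (n : ℕ) (F : ℕ → M)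
    (hF : ∀ i, n < i → F i = 0) :
    ∑ i ∈ Finset.range (n + 1), F i = ∑ k ∈ Finset.range (n / 2 + 1), F (2 * k)
      + ∑ k ∈ Finset.range ((n - 1) / 2 + 1), F (2 * k + 1) := by
  have key : ∀ m, ∑ i ∈ Finset.range (2 * m), F i = ∑ k ∈ Finset.range m, F (2 * k)
      + ∑ k ∈ Finset.range m, F (2 * k + 1) := by
    intro m
    induction m with
    | zero => simp
    | succ m ih =>
      rw [show 2 * (m + 1) = 2 * m + 1 + 1 by ring, Finset.sum_range_succ, Finset.sum_range_succ,
        ih, Finset.sum_range_succ, Finset.sum_range_succ]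
      abel
  have hext : ∑ i ∈ Finset.range (n + 1), F i = ∑ i ∈ Finset.range (2 * (n / 2 + 1)), F i := by
    refine Finset.sum_subset (by grind) fun i _ hi => hF i (by grind)
  rw [hext, key]
  congr 1
  refine (Finset.sum_subset (by grind) fun k _ hk => hF _ (by grind)).symm

lemma iteratedDeriv_sin_const_mul (c : ℝ) (i : ℕ) (x : ℝ) :
    iteratedDeriv i (fun y => Real.sin (c * y)) x = c ^ i * iteratedDeriv i Real.sin (c * x) := by
  rw [iteratedDeriv_comp_const_mul (Real.contDiff_sin)]

theorem reflection_iteratedDeriv_besselI (t : ℝ) (ht : 0 < t) (μ : ℝ) (n : ℕ) :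
    iteratedDeriv n (fun ν : ℝ => besselI ν t) μ
      + (-1 : ℝ) ^ (n + 1) * iteratedDeriv n (fun ν : ℝ => besselI ν t) (-μ)
      = -(2 / π) * Real.sin (π * μ) *
          ∑ k ∈ Finset.range (n / 2 + 1),
            (n.choose (2 * k) : ℝ) * (-π ^ 2) ^ k *
              iteratedDeriv (n - 2 * k) (fun ν : ℝ => besselK ν t) μ
        - 2 * Real.cos (π * μ) *
            ∑ k ∈ Finset.range ((n - 1) / 2 + 1),
              (n.choose (2 * k + 1) : ℝ) * (-π ^ 2) ^ k *
                iteratedDeriv (n - 2 * k - 1) (fun ν : ℝ => besselK ν t) μ := by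
  have hI := contDiff_besselI ht n
  have hfun : (fun ν => besselI ν t - besselI (-ν) t)
      = fun ν => -(2 / π) * (Real.sin (π * ν) * besselK ν t) :=
    funext (besselI_sub_besselI_neg ht)
  have hleft : iteratedDeriv n (fun ν => besselI ν t - besselI (-ν) t) μ
      = iteratedDeriv n (fun ν : ℝ => besselI ν t) μ
        + (-1 : ℝ) ^ (n + 1) * iteratedDeriv n (fun ν : ℝ => besselI ν t) (-μ) := by
    have hneg : ContDiff ℝ n fun ν => besselI (-ν) t := hI.comp contDiff_neg
    rw [iteratedDeriv_fun_sub hI.contDiffAt hneg.contDiffAt,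
      iteratedDeriv_comp_neg n (fun ν => besselI ν t), smul_eq_mul]
    ring
  have hsin : ContDiff ℝ n fun ν : ℝ => Real.sin (π * ν) := by fun_prop
  rw [← hleft, hfun, iteratedDeriv_const_mul_field,
    iteratedDeriv_fun_mul hsin.contDiffAt (contDiff_besselK ht n).contDiffAt,
    sum_range_succ_eq_even_add_odd n _ fun i hi => by simp [Nat.choose_eq_zero_of_lt hi],
    mul_add, sub_eq_add_neg, ← neg_mul, Finset.mul_sum, Finset.mul_sum, Finset.mul_sum,
    Finset.mul_sum]
  congr 1 <;> refine Finset.sum_congr rfl fun k _ => ?_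
  · rw [iteratedDeriv_sin_const_mul, Real.iteratedDeriv_even_sin, neg_pow (π ^ 2), pow_mul]
    simp only [Pi.mul_apply, Pi.pow_apply, Pi.neg_apply, Pi.one_apply]
    ring
  · rw [iteratedDeriv_sin_const_mul, Real.iteratedDeriv_odd_sin, neg_pow (π ^ 2), pow_succ π,
      pow_mul, Nat.sub_sub]
    simp only [Pi.mul_apply, Pi.pow_apply, Pi.neg_apply, Pi.one_apply]
    field_simp
end
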